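/- arXiv:2203.12096 — 2 statements merged into one kernel-verified Lean document; each statement's English description precedes it below -/
import Mathlib

section
/- Let 𝔹 be a centrally and stably oriented bivariant theory whose independent squares have the cancellation property, and let a class of very specialized morphisms be given. Then the orientation of 𝔹 is strong along every very specialized morphism: for every very specialized g : Y → Z and every morphism f : X → Y, the map − • θ(g) : 𝔹(X → Y) → 𝔹(X → Z) is an isomorphism of abelian groups. -/
open CategoryTheory CategoryTheory.Limits

universe w w' u' v u

/-- A bivariant functoriality on a category `C` with a final object and all fiber
products: a class of confined morphisms (containing all isomorphisms, closed under
composition and pullback), a class of independent Cartesian squares (containing all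
squares in which one pair of parallel sides consists of identities, closed under
horizontal and vertical composition) and a class of specialized morphisms
(containing all isomorphisms and closed under composition).

A square is recorded by its bottom `bot : X ⟶ Y`, top `top : X' ⟶ Y'`, left
vertical `l : X' ⟶ X` and right vertical `r : Y' ⟶ Y`; it is Cartesian when
`IsPullback top l r bot` holds. -/
structure BivFun (C : Type u) [Category.{v} C] where
  pt : C
  isTerminal_pt : IsTerminal pt
  hasPullbacks : HasPullbacks C
  confined : ∀ ⦃X Y : C⦄, (X ⟶ Y) → Prop
  confined_of_isIso : ∀ ⦃X Y : C⦄ (f : X ⟶ Y), IsIso f → confined f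
  confined_comp : ∀ ⦃X Y Z : C⦄ {f : X ⟶ Y} {g : Y ⟶ Z},
    confined f → confined g → confined (f ≫ g)
  confined_pullback : ∀ ⦃X Y X' Y' : C⦄ {bot : X ⟶ Y} {top : X' ⟶ Y'} {l : X' ⟶ X}
    {r : Y' ⟶ Y}, IsPullback top l r bot → confined bot → confined top
  indep : ∀ ⦃X Y X' Y' : C⦄ (bot : X ⟶ Y) (top : X' ⟶ Y') (l : X' ⟶ X) (r : Y' ⟶ Y), Prop
  indep_isPullback : ∀ ⦃X Y X' Y' : C⦄ {bot : X ⟶ Y} {top : X' ⟶ Y'} {l : X' ⟶ X}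
    {r : Y' ⟶ Y}, indep bot top l r → IsPullback top l r bot
  indep_vert_id : ∀ ⦃X Y : C⦄ (f : X ⟶ Y), indep f f (𝟙 X) (𝟙 Y)
  indep_horiz_id : ∀ ⦃X Y : C⦄ (f : X ⟶ Y), indep (𝟙 Y) (𝟙 X) f f
  indep_vcomp : ∀ ⦃X Y X' Y' X'' Y'' : C⦄ {f : X ⟶ Y} {f' : X' ⟶ Y'} {f'' : X'' ⟶ Y''}
    {l : X' ⟶ X} {r : Y' ⟶ Y} {l' : X'' ⟶ X'} {r' : Y'' ⟶ Y'},
    indep f f' l r → indep f' f'' l' r' → indep f f'' (l' ≫ l) (r' ≫ r)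
  indep_hcomp : ∀ ⦃X Y Z X' Y' Z' : C⦄ {f : X ⟶ Y} {g : Y ⟶ Z} {f' : X' ⟶ Y'}
    {g' : Y' ⟶ Z'} {l : X' ⟶ X} {m : Y' ⟶ Y} {r : Z' ⟶ Z},
    indep f f' l m → indep g g' m r → indep (f ≫ g) (f' ≫ g') l r
  specialized : ∀ ⦃X Y : C⦄, (X ⟶ Y) → Prop
  specialized_of_isIso : ∀ ⦃X Y : C⦄ (f : X ⟶ Y), IsIso f → specialized f
  specialized_comp : ∀ ⦃X Y Z : C⦄ {f : X ⟶ Y} {g : Y ⟶ Z},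
    specialized f → specialized g → specialized (f ≫ g)

variable {C : Type u} [Category.{v} C]

/-- The structure morphism to the final object `pt`. -/
def BivFun.tm (F : BivFun C) (X : C) : X ⟶ F.pt := F.isTerminal_pt.from X

/-- The data of a bivariant theory with functoriality `F`: an abelian group for every
morphism, bivariant pushforwards along confined morphisms, bivariant pullbacks along
independent squares, bivariant products, and units. -/
structure BivData (F : BivFun C) where
  grp : ∀ ⦃X Y : C⦄, (X ⟶ Y) → Type w
  addCommGroup : ∀ ⦃X Y : C⦄ (f : X ⟶ Y), AddCommGroup (grp f)
  push : ∀ ⦃X X' Y : C⦄ (g : X ⟶ X') (h : X' ⟶ Y), F.confined g → grp (g ≫ h) → grp h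
  pull : ∀ ⦃X Y X' Y' : C⦄ {bot : X ⟶ Y} {top : X' ⟶ Y'} {l : X' ⟶ X} {r : Y' ⟶ Y},
    F.indep bot top l r → grp bot → grp top
  mul : ∀ ⦃X Y Z : C⦄ {f : X ⟶ Y} {g : Y ⟶ Z}, grp f → grp g → grp (f ≫ g)
  one : ∀ (X : C), grp (𝟙 X)

attribute [instance] BivData.addCommGroup

variable {F : BivFun C}

/-- Transport of bivariant elements along an equality of morphisms. -/
def BivData.tr (B : BivData.{w} F) {X Y : C} {f g : X ⟶ Y} (h : f = g) :
    B.grp f → B.grp g := fun a => h ▸ a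

/-- The Fulton–MacPherson bivariant axioms. -/
structure IsBivTheory (B : BivData.{w} F) : Prop where
  push_add : ∀ ⦃X X' Y : C⦄ (g : X ⟶ X') (h : X' ⟶ Y) (hg : F.confined g)
    (α β : B.grp (g ≫ h)), B.push g h hg (α + β) = B.push g h hg α + B.push g h hg β
  pull_add : ∀ ⦃X Y X' Y' : C⦄ {bot : X ⟶ Y} {top : X' ⟶ Y'} {l : X' ⟶ X} {r : Y' ⟶ Y}
    (hsq : F.indep bot top l r) (α β : B.grp bot),
    B.pull hsq (α + β) = B.pull hsq α + B.pull hsq β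
  mul_add_left : ∀ ⦃X Y Z : C⦄ {f : X ⟶ Y} {g : Y ⟶ Z} (α α' : B.grp f) (β : B.grp g),
    B.mul (α + α') β = B.mul α β + B.mul α' β
  mul_add_right : ∀ ⦃X Y Z : C⦄ {f : X ⟶ Y} {g : Y ⟶ Z} (α : B.grp f) (β β' : B.grp g),
    B.mul α (β + β') = B.mul α β + B.mul α β'
  mul_assoc : ∀ ⦃X Y Z W : C⦄ {f : X ⟶ Y} {g : Y ⟶ Z} {h : Z ⟶ W}
    (α : B.grp f) (β : B.grp g) (γ : B.grp h),
    B.mul (B.mul α β) γ = B.tr (Category.assoc f g h).symm (B.mul α (B.mul β γ))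
  push_id : ∀ ⦃X Y : C⦄ (f : X ⟶ Y) (h1 : F.confined (𝟙 X)) (α : B.grp (𝟙 X ≫ f)),
    B.push (𝟙 X) f h1 α = B.tr (Category.id_comp f) α
  push_comp : ∀ ⦃X X' X'' Y : C⦄ (f : X ⟶ X') (g : X' ⟶ X'') (h : X'' ⟶ Y)
    (hf : F.confined f) (hg : F.confined g) (α : B.grp (f ≫ g ≫ h)),
    B.push g h hg (B.push f (g ≫ h) hf α) =
      B.push (f ≫ g) h (F.confined_comp hf hg) (B.tr (Category.assoc f g h).symm α)
  pull_id : ∀ ⦃X Y : C⦄ (f : X ⟶ Y) (α : B.grp f), B.pull (F.indep_vert_id f) α = α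
  pull_comp : ∀ ⦃X Y X' Y' X'' Y'' : C⦄ {f : X ⟶ Y} {f' : X' ⟶ Y'} {f'' : X'' ⟶ Y''}
    {l : X' ⟶ X} {r : Y' ⟶ Y} {l' : X'' ⟶ X'} {r' : Y'' ⟶ Y'}
    (h1 : F.indep f f' l r) (h2 : F.indep f' f'' l' r') (α : B.grp f),
    B.pull h2 (B.pull h1 α) = B.pull (F.indep_vcomp h1 h2) α
  push_mul : ∀ ⦃X X' Y Z : C⦄ (f : X ⟶ X') (h : X' ⟶ Y) (g : Y ⟶ Z) (hf : F.confined f)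
    (α : B.grp (f ≫ h)) (β : B.grp g),
    B.push f (h ≫ g) hf (B.tr (Category.assoc f h g) (B.mul α β)) =
      B.mul (B.push f h hf α) β
  pull_mul : ∀ ⦃X Y Z X' Y' Z' : C⦄ {f : X ⟶ Y} {g : Y ⟶ Z} {f' : X' ⟶ Y'} {g' : Y' ⟶ Z'}
    {l : X' ⟶ X} {m : Y' ⟶ Y} {r : Z' ⟶ Z}
    (h1 : F.indep f f' l m) (h2 : F.indep g g' m r) (α : B.grp f) (β : B.grp g),
    B.pull (F.indep_hcomp h1 h2) (B.mul α β) = B.mul (B.pull h1 α) (B.pull h2 β)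
  push_pull : ∀ ⦃X Y Z X' Y' Z' : C⦄ (f : X ⟶ Y) (k : Y ⟶ Z) (f' : X' ⟶ Y') (k' : Y' ⟶ Z')
    (l : X' ⟶ X) (m : Y' ⟶ Y) (r : Z' ⟶ Z) (hf : F.confined f)
    (hleft : IsPullback f' l m f) (hbig : F.indep (f ≫ k) (f' ≫ k') l r)
    (hright : F.indep k k' m r) (α : B.grp (f ≫ k)),
    B.pull hright (B.push f k hf α) =
      B.push f' k' (F.confined_pullback hleft hf) (B.pull hbig α)
  proj_formula : ∀ ⦃X Y X' Y' Z : C⦄ {b : X' ⟶ Y'} {t : X ⟶ Y} {g' : X ⟶ X'} {g : Y ⟶ Y'}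
    (hsq : F.indep b t g' g) (hg : F.confined g) (c : Y' ⟶ Z)
    (α : B.grp (g ≫ c)) (β : B.grp b),
    B.push g' (b ≫ c) (F.confined_pullback (F.indep_isPullback hsq).flip hg)
        (B.tr (by rw [← Category.assoc, (F.indep_isPullback hsq).w, Category.assoc])
          (B.mul (B.pull hsq β) α)) =
      B.mul β (B.push g c hg α)
  one_mul : ∀ ⦃X Y : C⦄ {f : X ⟶ Y} (α : B.grp f),
    B.tr (Category.id_comp f) (B.mul (B.one X) α) = α
  mul_one : ∀ ⦃X Y : C⦄ {f : X ⟶ Y} (α : B.grp f),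
    B.tr (Category.comp_id f) (B.mul α (B.one Y)) = α

/-- The cohomology pullback `f^* : 𝔹^•(Y) → 𝔹^•(X)` along an arbitrary morphism, using
the independent square whose horizontal sides are `f` and whose vertical sides are
identities. -/
def cohPull (B : BivData.{w} F) {X Y : C} (f : X ⟶ Y) : B.grp (𝟙 Y) → B.grp (𝟙 X) :=
  B.pull (F.indep_horiz_id f)

/-- The ring multiplication on the cohomology `𝔹^•(X) = 𝔹(𝟙 X)`. -/
def cohMul (B : BivData.{w} F) {X : C} (α β : B.grp (𝟙 X)) : B.grp (𝟙 X) :=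
  B.tr (Category.id_comp (𝟙 X)) (B.mul α β)

/-- The homology pushforward `f_* : 𝔹_•(X) → 𝔹_•(Y)` along a confined morphism. -/
def homPush (B : BivData.{w} F) {X Y : C} (f : X ⟶ Y) (hf : F.confined f) :
    B.grp (F.tm X) → B.grp (F.tm Y) :=
  fun a => B.push f (F.tm Y) hf (B.tr (F.isTerminal_pt.hom_ext _ _) a)

/-- The left action of the cohomology ring `𝔹^•(X)` on the homology `𝔹_•(X)`. -/
def cohSmul (B : BivData.{w} F) {X : C} (α : B.grp (𝟙 X)) (a : B.grp (F.tm X)) :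
    B.grp (F.tm X) :=
  B.tr (Category.id_comp (F.tm X)) (B.mul α a)

/-- An orientation of a bivariant theory: a canonical element `θ(f)` for every
specialized morphism, normalized and multiplicative. -/
structure BivOrientation (B : BivData.{w} F) where
  θ : ∀ ⦃X Y : C⦄ (f : X ⟶ Y), F.specialized f → B.grp f
  θ_id : ∀ (X : C), θ (𝟙 X) (F.specialized_of_isIso (𝟙 X) inferInstance) = B.one X
  θ_comp : ∀ ⦃X Y Z : C⦄ (f : X ⟶ Y) (g : Y ⟶ Z) (hf : F.specialized f)
    (hg : F.specialized g),
    θ (f ≫ g) (F.specialized_comp hf hg) = B.mul (θ f hf) (θ g hg)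

/-- A stable orientation: specialized morphisms are stable under independent
pullbacks, and the orientation is stable under independent pullbacks. -/
structure StableOrientation (B : BivData.{w} F) extends BivOrientation B where
  specialized_pullback : ∀ ⦃X Y X' Y' : C⦄ {bot : X ⟶ Y} {top : X' ⟶ Y'} {l : X' ⟶ X}
    {r : Y' ⟶ Y}, F.indep bot top l r → F.specialized bot → F.specialized top
  θ_pullback : ∀ ⦃X Y X' Y' : C⦄ {bot : X ⟶ Y} {top : X' ⟶ Y'} {l : X' ⟶ X}
    {r : Y' ⟶ Y} (hsq : F.indep bot top l r) (hs : F.specialized bot),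
    B.pull hsq (θ bot hs) = θ top (specialized_pullback hsq hs)

variable {B : BivData.{w} F}

/-- The Gysin pushforward `f_! : 𝔹^•(X) → 𝔹^•(Y)`, `f_!(α) = f_*(α • θ(f))`, along a
confined and specialized morphism. -/
def BivOrientation.gysinPush (O : BivOrientation B) {X Y : C} (f : X ⟶ Y)
    (hc : F.confined f) (hs : F.specialized f) : B.grp (𝟙 X) → B.grp (𝟙 Y) :=
  fun α => B.push f (𝟙 Y) hc
    (B.tr (show 𝟙 X ≫ f = f ≫ 𝟙 Y by simp) (B.mul α (O.θ f hs)))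

/-- The Gysin pullback `g^! : 𝔹_•(Y) → 𝔹_•(X)`, `g^!(β) = θ(g) • β`, along a
specialized morphism. -/
def BivOrientation.gysinPull (O : BivOrientation B) {X Y : C} (g : X ⟶ Y)
    (hs : F.specialized g) : B.grp (F.tm Y) → B.grp (F.tm X) :=
  fun a => B.tr (F.isTerminal_pt.hom_ext _ _) (B.mul (O.θ g hs) a)

/-- A centrally (and stably) oriented bivariant theory: the class of independent
squares is symmetric (closed under transposition), and for every independent square
with specialized bottom `f` and right side `g`, `g^*(θ(f)) • α = f^*(α) • θ(f)`,
where `f^*` is the pullback along the transposed square. -/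
structure CentralOrientation (B : BivData.{w} F) extends StableOrientation B where
  indep_symm : ∀ ⦃X Y X' Y' : C⦄ {bot : X ⟶ Y} {top : X' ⟶ Y'} {l : X' ⟶ X}
    {r : Y' ⟶ Y}, F.indep bot top l r → F.indep r l top bot
  central : ∀ ⦃X Y X' Y' : C⦄ {f : X ⟶ Y} {top : X' ⟶ Y'} {l : X' ⟶ X} {g : Y' ⟶ Y}
    (hsq : F.indep f top l g) (hf : F.specialized f) (α : B.grp g),
    B.mul (B.pull hsq (θ f hf)) α =
      B.tr (F.indep_isPullback hsq).w.symm (B.mul (B.pull (indep_symm hsq) α) (θ f hf))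

/-- Every absolute product square (the Cartesian square with corners `X × Y`, `X`,
`Y`, `pt`) is independent. -/
def AbsIndep (F : BivFun C) : Prop :=
  ∀ ⦃X Y P : C⦄ (p1 : P ⟶ X) (p2 : P ⟶ Y),
    IsPullback p1 p2 (F.tm X) (F.tm Y) → F.indep (F.tm X) p2 p1 (F.tm Y)

/-- Vertical cancellation for independent squares: for a vertical composite of two
Cartesian squares, independence of the composite square and of the bottom square
implies independence of the top square. -/
def CancelVert (F : BivFun C) : Prop :=
  ∀ ⦃X Y X' Y' X'' Y'' : C⦄ {f : X ⟶ Y} {f' : X' ⟶ Y'} {f'' : X'' ⟶ Y''}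
    {l : X' ⟶ X} {r : Y' ⟶ Y} {l' : X'' ⟶ X'} {r' : Y'' ⟶ Y'},
    IsPullback f'' l' r' f' → F.indep f f'' (l' ≫ l) (r' ≫ r) → F.indep f f' l r →
      F.indep f' f'' l' r'

/-- Horizontal cancellation for independent squares: for a horizontal composite of two
Cartesian squares, independence of the composite square and of the right-hand square
implies independence of the left-hand square. -/
def CancelHoriz (F : BivFun C) : Prop :=
  ∀ ⦃X Y Z X' Y' Z' : C⦄ {f : X ⟶ Y} {g : Y ⟶ Z} {f' : X' ⟶ Y'} {g' : Y' ⟶ Z'}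
    {l : X' ⟶ X} {m : Y' ⟶ Y} {r : Z' ⟶ Z},
    IsPullback f' l m f → F.indep (f ≫ g) (f' ≫ g') l r → F.indep g g' m r →
      F.indep f f' l m

/-- A class of very specialized morphisms: a subclass of the specialized morphisms,
stable under composition and pullback, such that every Cartesian square having a very
specialized morphism as one of its sides is independent, and such that any section
of a very specialized morphism is specialized. -/
structure VerySpec (F : BivFun C) where
  vs : ∀ ⦃X Y : C⦄, (X ⟶ Y) → Prop
  subset : ∀ ⦃X Y : C⦄ (f : X ⟶ Y), vs f → F.specialized f
  comp : ∀ ⦃X Y Z : C⦄ {f : X ⟶ Y} {g : Y ⟶ Z}, vs f → vs g → vs (f ≫ g)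
  pullback : ∀ ⦃X Y X' Y' : C⦄ {bot : X ⟶ Y} {top : X' ⟶ Y'} {l : X' ⟶ X}
    {r : Y' ⟶ Y}, IsPullback top l r bot → vs bot → vs top
  indep_of_side : ∀ ⦃X Y X' Y' : C⦄ {bot : X ⟶ Y} {top : X' ⟶ Y'} {l : X' ⟶ X}
    {r : Y' ⟶ Y}, IsPullback top l r bot → (vs bot ∨ vs top ∨ vs l ∨ vs r) →
    F.indep bot top l r
  sect : ∀ ⦃X Y : C⦄ (f : X ⟶ Y), vs f → ∀ (s : Y ⟶ X), s ≫ f = 𝟙 Y →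
    F.specialized s

namespace BivData

theorem tr_heq (B : BivData.{w} F) {X Y : C} {f g : X ⟶ Y} (h : f = g) (a : B.grp f) :
    HEq (B.tr h a) a := by
  subst h; rfl

theorem mul_heq (B : BivData.{w} F) {X Y Z : C} {f f' : X ⟶ Y} {g g' : Y ⟶ Z} (hf : f = f')
    (hg : g = g') {α : B.grp f} {α' : B.grp f'} {β : B.grp g} {β' : B.grp g'}
    (hα : HEq α α') (hβ : HEq β β') : HEq (B.mul α β) (B.mul α' β') := by
  subst hf hg
  rw [eq_of_heq hα, eq_of_heq hβ]

end BivData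

namespace IsBivTheory

theorem mul_assoc_heq (hB : IsBivTheory B) {X Y Z W : C} {f : X ⟶ Y} {g : Y ⟶ Z} {h : Z ⟶ W}
    (α : B.grp f) (β : B.grp g) (γ : B.grp h) :
    HEq (B.mul (B.mul α β) γ) (B.mul α (B.mul β γ)) :=
  (heq_of_eq (hB.mul_assoc α β γ)).trans (B.tr_heq _ _)

theorem one_mul_heq (hB : IsBivTheory B) {X Y : C} {f : X ⟶ Y} (α : B.grp f) :
    HEq (B.mul (B.one X) α) α :=
  (B.tr_heq (Category.id_comp f) _).symm.trans (heq_of_eq (hB.one_mul α))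

theorem mul_one_heq (hB : IsBivTheory B) {X Y : C} {f : X ⟶ Y} (α : B.grp f) :
    HEq (B.mul α (B.one Y)) α :=
  (B.tr_heq (Category.comp_id f) _).symm.trans (heq_of_eq (hB.mul_one α))

theorem pull_eq_self (hB : IsBivTheory B) {X Y : C} {f : X ⟶ Y} {l : X ⟶ X} {r : Y ⟶ Y}
    (hl : l = 𝟙 X) (hr : r = 𝟙 Y) (hsq : F.indep f f l r) (α : B.grp f) :
    B.pull hsq α = α := by
  subst hl hr
  exact hB.pull_id f α

end IsBivTheory

theorem BivOrientation.θ_heq (O : BivOrientation B) {X Y : C} {f g : X ⟶ Y} (h : f = g)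
    (hf : F.specialized f) (hg : F.specialized g) : HEq (O.θ f hf) (O.θ g hg) := by
  subst h; rfl

/-- If `s ≫ p = 𝟙 X`, then `θ(s) • θ(p)` is the unit. -/
theorem BivOrientation.θ_mul_θ_of_section (O : BivOrientation B) {X Y : C} {s : X ⟶ Y}
    {p : Y ⟶ X} (h : s ≫ p = 𝟙 X) (hs : F.specialized s) (hp : F.specialized p) :
    HEq (B.mul (O.θ s hs) (O.θ p hp)) (B.one X) := by
  rw [← O.θ_comp, ← O.θ_id]
  exact O.θ_heq h _ _

namespace CentralOrientation

theorem central_heq (O : CentralOrientation B) {X Y X' Y' : C} {f : X ⟶ Y} {top : X' ⟶ Y'}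
    {l : X' ⟶ X} {g : Y' ⟶ Y} (hsq : F.indep f top l g) (hf : F.specialized f)
    (α : B.grp g) :
    HEq (B.mul (O.θ top (O.specialized_pullback hsq hf)) α)
      (B.mul (B.pull (O.indep_symm hsq) α) (O.θ f hf)) := by
  rw [← O.θ_pullback hsq hf, O.central hsq hf α]
  exact B.tr_heq _ _

/-- Pulling `β` back along `g` and multiplying by the orientation of a section `s` of the
projection `p` yields a preimage of `β` under `− • θ(g)`. -/
theorem section_mul_pull_mul_θ (hB : IsBivTheory B) (O : CentralOrientation B) {P X Y Z : C}
    {h : X ⟶ Z} {q : P ⟶ Y} {p : P ⟶ X} {g : Y ⟶ Z} {s : X ⟶ P}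
    (hsq : F.indep h q p g) (hg : F.specialized g) (hs : F.specialized s)
    (hsp : s ≫ p = 𝟙 X) (β : B.grp h) :
    HEq (B.mul (B.mul (O.θ s hs) (B.pull hsq β)) (O.θ g hg)) β := by
  have hp := O.specialized_pullback (O.indep_symm hsq) hg
  have hw := (F.indep_isPullback hsq).w
  have h₁ : HEq (B.mul (B.pull hsq β) (O.θ g hg)) (B.mul (O.θ p hp) β) :=
    (O.central_heq (O.indep_symm hsq) hg β).symm
  have h₂ : HEq (B.mul (B.mul (O.θ s hs) (O.θ p hp)) β) (B.mul (B.one X) β) :=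
    B.mul_heq hsp rfl (O.θ_mul_θ_of_section hsp hs hp) HEq.rfl
  exact (hB.mul_assoc_heq _ _ _).trans <| (B.mul_heq rfl hw HEq.rfl h₁).trans <|
    (hB.mul_assoc_heq _ _ _).symm.trans <| h₂.trans <| hB.one_mul_heq β

/-- Pulling `α • θ(g)` back along `g` and multiplying by the orientation of the section `s`
induced by the diagonal `d` recovers `α`. -/
theorem section_mul_pull_mul_θ_eq_self (hB : IsBivTheory B) (O : CentralOrientation B)
    {P Q X Y Z : C} {f : X ⟶ Y} {g : Y ⟶ Z} {f' : P ⟶ Q} {q₁ q₂ : Q ⟶ Y} {p : P ⟶ X}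
    {s : X ⟶ P} {d : Y ⟶ Q}
    (hleft : F.indep f f' p q₁) (hright : F.indep g q₂ q₁ g) (hd : F.indep f' f s d)
    (hg : F.specialized g) (hs : F.specialized s) (hds : F.specialized d)
    (hsp : s ≫ p = 𝟙 X) (hd₁ : d ≫ q₁ = 𝟙 Y) (hd₂ : d ≫ q₂ = 𝟙 Y) (α : B.grp f) :
    HEq (B.mul (O.θ s hs) (B.pull (F.indep_hcomp hleft hright) (B.mul α (O.θ g hg)))) α := by
  have hq := O.specialized_pullback hright hg
  have hα : B.pull hd (B.pull hleft α) = α := by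
    rw [hB.pull_comp]
    exact hB.pull_eq_self hsp hd₁ _ α
  have hw := (F.indep_isPullback hd).w
  rw [hB.pull_mul hleft hright, O.θ_pullback hright hg]
  have hc := O.central_heq (O.indep_symm hd) hds (B.pull hleft α)
  rw [hα] at hc
  have hu : HEq (B.mul α (B.mul (O.θ d hds) (O.θ q₂ hq))) (B.mul α (B.one Y)) :=
    B.mul_heq rfl hd₂ HEq.rfl (O.θ_mul_θ_of_section hd₂ hds hq)
  exact (hB.mul_assoc_heq _ _ _).symm.trans <| (B.mul_heq hw.symm rfl hc HEq.rfl).trans <|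
    (hB.mul_assoc_heq _ _ _).trans <| hu.trans <| hB.mul_one_heq α

end CentralOrientation

/-- Let `𝔹` be a centrally and stably oriented bivariant theory whose
independent squares have the cancellation property, and let a class of very
specialized morphisms be given.  Then the orientation of `𝔹` is strong along every
very specialized morphism: for every very specialized `g : Y ⟶ Z` and every
`f : X ⟶ Y`, the map `− • θ(g) : 𝔹(X → Y) → 𝔹(X → Z)` is an isomorphism of abelian
groups (it is additive by bi-additivity of the bivariant product, and bijective). -/
theorem strong_orientation_of_verySpecialized {C : Type u} [Category.{v} C]
    (F : BivFun C) (B : BivData.{w} F) (hB : IsBivTheory B)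
    (O : CentralOrientation B) (hcv : CancelVert F) (hch : CancelHoriz F)
    (V : VerySpec F) {X Y Z : C} (g : Y ⟶ Z) (hg : V.vs g) (f : X ⟶ Y) :
    Function.Bijective (fun α : B.grp f => B.mul α (O.θ g (V.subset g hg))) := by
  have := F.hasPullbacks
  have hQ : IsPullback (pullback.fst g g) (pullback.snd g g) g g := .of_hasPullback g g
  set q₂ := pullback.fst g g
  set q₁ := pullback.snd g g
  have hP : IsPullback (pullback.fst q₁ f) (pullback.snd q₁ f) q₁ f := .of_hasPullback q₁ f
  set f' := pullback.fst q₁ f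
  set p := pullback.snd q₁ f
  have hq₁ : V.vs q₁ := V.pullback hQ.flip hg
  obtain ⟨d, hd₂, hd₁⟩ : ∃ d, d ≫ q₂ = 𝟙 Y ∧ d ≫ q₁ = 𝟙 Y :=
    ⟨hQ.lift (𝟙 Y) (𝟙 Y) rfl, hQ.lift_fst _ _ _, hQ.lift_snd _ _ _⟩
  obtain ⟨s, hsf, hsp⟩ : ∃ s, s ≫ f' = f ≫ d ∧ s ≫ p = 𝟙 X :=
    ⟨hP.lift (f ≫ d) (𝟙 X) (by simp [hd₁]), hP.lift_fst _ _ _, hP.lift_snd _ _ _⟩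
  have hleft : F.indep f f' p q₁ := V.indep_of_side hP (.inr (.inr (.inr hq₁)))
  have hright : F.indep g q₂ q₁ g := V.indep_of_side hQ (.inl hg)
  have hds : F.specialized d := V.sect q₁ hq₁ d hd₁
  have hs : F.specialized s := V.sect p (V.pullback hP.flip hq₁) s hsp
  have hcomp : F.indep f f (s ≫ p) (d ≫ q₁) := by
    rw [hsp, hd₁]
    exact F.indep_vert_id f
  have hdsq : F.indep f' f s d :=
    hcv (IsPullback.of_bot (F.indep_isPullback hcomp) hsf.symm hP) hcomp hleft
  have hsq : s ≫ f' ≫ q₂ = f := by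
    rw [← Category.assoc, hsf, Category.assoc, hd₂, Category.comp_id]
  refine Function.bijective_iff_has_inverse.mpr
    ⟨fun β => B.tr hsq (B.mul (O.θ s hs) (B.pull (F.indep_hcomp hleft hright) β)),
      fun α => eq_of_heq ?_, fun β => eq_of_heq ?_⟩
  · exact (B.tr_heq _ _).trans
      (O.section_mul_pull_mul_θ_eq_self hB hleft hright hdsq _ hs hds hsp hd₁ hd₂ α)
  · exact (B.mul_heq hsq.symm rfl (B.tr_heq _ _) HEq.rfl).trans
      (O.section_mul_pull_mul_θ hB _ _ hs hsp β)
end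

section
/- Let 𝔹 be a centrally and stably oriented bivariant theory such that all absolute product squares are independent and the independent squares have the cancellation property, let a class of very specialized morphisms be given, and let X be an object whose structure morphism π_X : X → pt is very specialized. Then − • θ(π_X) : 𝔹^•(X) → 𝔹_•(X) is an isomorphism of abelian groups, and for all α, β ∈ 𝔹^•(X) one has (α • β) • θ(π_X) = (α • θ(π_X)) ⌢ (β • θ(π_X)); in particular the intersection product ⌢ on 𝔹_•(X) is associative. -/
open CategoryTheory CategoryTheory.Limits

universe w w' u' v u

variable {C : Type u} [Category.{v} C]

variable {F : BivFun C}

variable {B : BivData.{w} F}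

/-- The homological cross product `α × β := π^*(α) • β ∈ 𝔹_•(X × Y)`, where `π^*` is
the pullback along the (independent) absolute product square with right-hand vertical
`π_Y : Y ⟶ pt`, top `p2 : P ⟶ Y` and left vertical `p1 : P ⟶ X`. -/
def homCross (B : BivData.{w} F) {X Y P : C} {p1 : P ⟶ X} {p2 : P ⟶ Y}
    (hind : F.indep (F.tm X) p2 p1 (F.tm Y)) (a : B.grp (F.tm X))
    (b : B.grp (F.tm Y)) : B.grp (F.tm P) :=
  B.tr (F.isTerminal_pt.hom_ext _ _) (B.mul (B.pull hind a) b)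

variable {B : BivData.{w} F}

/-- Capping with the fundamental class: `α ↦ α • θ(π_X) : 𝔹^•(X) → 𝔹_•(X)`, for an
object `X` whose structure morphism `π_X : X ⟶ pt` is very specialized. -/
def poincareDual (O : CentralOrientation B) (V : VerySpec F) {X : C}
    (hvs : V.vs (F.tm X)) (α : B.grp (𝟙 X)) : B.grp (F.tm X) :=
  B.tr (Category.id_comp (F.tm X)) (B.mul α (O.θ (F.tm X) (V.subset (F.tm X) hvs)))

/-- The intersection product `a ⌢ b := Δ^!(a × b)` on `𝔹_•(X)`, for an object `X`
whose structure morphism is very specialized; here `P = X × X` with projections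
`p1, p2` and diagonal `d = Δ : X ⟶ P`, which is specialized as a section of the very
specialized projection `p1`. -/
def interProd (habs : AbsIndep F) (O : CentralOrientation B) (V : VerySpec F)
    {X P : C} (p1 p2 : P ⟶ X) (hP : IsPullback p1 p2 (F.tm X) (F.tm X))
    (d : X ⟶ P) (hd1 : d ≫ p1 = 𝟙 X) (hvs : V.vs (F.tm X))
    (a b : B.grp (F.tm X)) : B.grp (F.tm X) :=
  O.toBivOrientation.gysinPull d (V.sect p1 (V.pullback hP hvs) d hd1)
    (homCross B (habs p1 p2 hP) a b)

theorem BivData.tr_tr (B : BivData.{w} F) {X Y : C} {f g h : X ⟶ Y} (hfg : f = g)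
    (hgh : g = h) (a : B.grp f) : B.tr hgh (B.tr hfg a) = B.tr (hfg.trans hgh) a := by
  subst hfg hgh; rfl

theorem BivData.tr_rfl (B : BivData.{w} F) {X Y : C} {f : X ⟶ Y} (h : f = f)
    (a : B.grp f) : B.tr h a = a := rfl

theorem BivData.tr_mul (B : BivData.{w} F) {X Y Z : C} {f f' : X ⟶ Y} {g : Y ⟶ Z}
    (h : f = f') (a : B.grp f) (b : B.grp g) :
    B.mul (B.tr h a) b = B.tr (congrArg (· ≫ g) h) (B.mul a b) := by
  subst h; rfl

theorem BivData.mul_tr (B : BivData.{w} F) {X Y Z : C} {f : X ⟶ Y} {g g' : Y ⟶ Z}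
    (h : g = g') (a : B.grp f) (b : B.grp g) :
    B.mul a (B.tr h b) = B.tr (congrArg (f ≫ ·) h) (B.mul a b) := by
  subst h; rfl

theorem BivData.pull_tr (B : BivData.{w} F) {X Y X' Y' : C} {bot bot' : X ⟶ Y}
    {top top' : X' ⟶ Y'} {l l' : X' ⟶ X} {r r' : Y' ⟶ Y} (hsq : F.indep bot top l r)
    (hsq' : F.indep bot' top' l' r') (hb : bot = bot') (ht : top = top') (hl : l = l')
    (hr : r = r') (a : B.grp bot) :
    B.pull hsq' (B.tr hb a) = B.tr ht (B.pull hsq a) := by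
  subst hb ht hl hr; rfl

theorem BivOrientation.tr_θ (O : BivOrientation B) {X Y : C} {f g : X ⟶ Y} (h : f = g)
    (hf : F.specialized f) (hg : F.specialized g) : B.tr h (O.θ f hf) = O.θ g hg := by
  subst h; rfl

/-- If `f ≫ g = 𝟙 X`, then `θ(f) • θ(g) = 1_X`. -/
theorem BivOrientation.θ_mul_θ_of_comp_eq_id (O : BivOrientation B) {X Y : C} {f : X ⟶ Y}
    {g : Y ⟶ X} (h : f ≫ g = 𝟙 X) (hf : F.specialized f) (hg : F.specialized g) :
    B.mul (O.θ f hf) (O.θ g hg) = B.tr h.symm (B.one X) := by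
  rw [← O.θ_comp f g hf hg, ← O.θ_id X]
  exact (O.tr_θ h.symm _ _).symm

theorem IsBivTheory.one_mul_eq_tr (hB : IsBivTheory B) {X Y : C} {f : X ⟶ Y} (a : B.grp f) :
    B.mul (B.one X) a = B.tr (Category.id_comp f).symm a := by
  conv_rhs => rw [← hB.one_mul a]
  rw [B.tr_tr, B.tr_rfl]

theorem IsBivTheory.mul_one_eq_tr (hB : IsBivTheory B) {X Y : C} {f : X ⟶ Y} (a : B.grp f) :
    B.mul a (B.one Y) = B.tr (Category.comp_id f).symm a := by
  conv_rhs => rw [← hB.mul_one a]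
  rw [B.tr_tr, B.tr_rfl]

/-- Pulling back a cohomology class along a morphism and then along a section of it
gives back the class. -/
theorem IsBivTheory.cohPull_cohPull_of_comp_eq_id (hB : IsBivTheory B) {X Y : C}
    {f : X ⟶ Y} {g : Y ⟶ X} (h : f ≫ g = 𝟙 X) (a : B.grp (𝟙 X)) :
    cohPull B f (cohPull B g a) = a := by
  unfold cohPull
  rw [hB.pull_comp (F.indep_horiz_id g) (F.indep_horiz_id f) a]
  have := B.pull_tr (F.indep_vert_id (𝟙 X))
    (F.indep_vcomp (F.indep_horiz_id g) (F.indep_horiz_id f)) rfl rfl h.symm h.symm a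
  rwa [B.tr_rfl, B.tr_rfl, hB.pull_id] at this

/-- Centrality applied to the square with identity vertical sides:
`θ(f) • α = f^*(α) • θ(f)` for a cohomology class `α`. -/
theorem CentralOrientation.θ_mul_coh (O : CentralOrientation B) (hB : IsBivTheory B)
    {X Y : C} (f : X ⟶ Y) (hf : F.specialized f) (a : B.grp (𝟙 Y)) :
    B.mul (O.θ f hf) a =
      B.tr ((Category.id_comp f).trans (Category.comp_id f).symm)
        (B.mul (cohPull B f a) (O.θ f hf)) := by
  have := O.central (F.indep_vert_id f) hf a
  rwa [hB.pull_id] at this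

/-- The candidate inverse `a ↦ θ(Δ) • π_X^*(a)` of capping with the fundamental class. -/
def poincareDualInv (habs : AbsIndep F) (O : CentralOrientation B) (V : VerySpec F)
    {X P : C} (p1 p2 : P ⟶ X) (hP : IsPullback p1 p2 (F.tm X) (F.tm X))
    (d : X ⟶ P) (hd1 : d ≫ p1 = 𝟙 X) (hd2 : d ≫ p2 = 𝟙 X) (hvs : V.vs (F.tm X))
    (a : B.grp (F.tm X)) : B.grp (𝟙 X) :=
  B.tr hd2 (B.mul (O.θ d (V.sect p1 (V.pullback hP hvs) d hd1))
    (B.pull (habs p1 p2 hP) a))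

section

variable (habs : AbsIndep F) (O : CentralOrientation B)
  (V : VerySpec F) {X P : C} (p1 p2 : P ⟶ X) (hP : IsPullback p1 p2 (F.tm X) (F.tm X))
  (d : X ⟶ P) (hd1 : d ≫ p1 = 𝟙 X) (hd2 : d ≫ p2 = 𝟙 X) (hvs : V.vs (F.tm X))

theorem interProd_eq_cohSmul (hB : IsBivTheory B) (a b : B.grp (F.tm X)) :
    interProd habs O V p1 p2 hP d hd1 hvs a b =
      cohSmul B (poincareDualInv habs O V p1 p2 hP d hd1 hd2 hvs a) b := by
  simp only [interProd, BivOrientation.gysinPull, homCross, cohSmul, poincareDualInv,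
    B.mul_tr, B.tr_mul, hB.mul_assoc, B.tr_tr]

theorem poincareDual_poincareDualInv (hB : IsBivTheory B) (a : B.grp (F.tm X)) :
    poincareDual O V hvs (poincareDualInv habs O V p1 p2 hP d hd1 hd2 hvs a) = a := by
  have hc := O.central (habs p2 p1 hP.flip) (V.subset _ hvs) a
  rw [O.θ_pullback] at hc
  have hc' := congrArg (B.tr (F.indep_isPullback (habs p2 p1 hP.flip)).w) hc
  rw [B.tr_tr, B.tr_rfl] at hc'
  unfold poincareDual poincareDualInv
  rw [B.tr_mul, hB.mul_assoc, ← hc', B.mul_tr, B.tr_tr, B.tr_tr, B.tr_tr]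
  have h := congrArg (B.tr (Category.assoc d p1 (F.tm X)))
    (hB.mul_assoc (O.θ d (V.sect p1 (V.pullback hP hvs) d hd1))
      (O.θ p1 (O.specialized_pullback (habs p2 p1 hP.flip) (V.subset _ hvs))) a)
  rw [B.tr_tr, B.tr_rfl] at h
  rw [← h, O.θ_mul_θ_of_comp_eq_id hd1, B.tr_mul, hB.one_mul_eq_tr]
  simp only [B.tr_tr, B.tr_rfl]

theorem poincareDualInv_poincareDual (hB : IsBivTheory B) (α : B.grp (𝟙 X)) :
    poincareDualInv habs O V p1 p2 hP d hd1 hd2 hvs (poincareDual O V hvs α) = α := by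
  have hm := hB.pull_mul (F.indep_horiz_id p1) (habs p1 p2 hP) α
    (O.θ (F.tm X) (V.subset _ hvs))
  rw [O.θ_pullback] at hm
  unfold poincareDual poincareDualInv
  rw [B.pull_tr (F.indep_hcomp (F.indep_horiz_id p1) (habs p1 p2 hP)) (habs p1 p2 hP)
    (Category.id_comp _) (Category.id_comp _) rfl rfl, hm, B.mul_tr, B.tr_tr]
  have h := congrArg (B.tr (Category.assoc d (𝟙 P) p2))
    (hB.mul_assoc (O.θ d (V.sect p1 (V.pullback hP hvs) d hd1))
      (cohPull B p1 α) (O.θ p2 (O.specialized_pullback (habs p1 p2 hP) (V.subset _ hvs))))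
  rw [B.tr_tr, B.tr_rfl] at h
  change B.tr _ (B.mul _ (B.mul (cohPull B p1 α) _)) = _
  rw [← h, O.θ_mul_coh hB, hB.cohPull_cohPull_of_comp_eq_id hd1, B.tr_mul, hB.mul_assoc,
    O.θ_mul_θ_of_comp_eq_id hd2, B.mul_tr, hB.mul_one_eq_tr]
  simp only [B.tr_tr, B.tr_rfl]

end

theorem poincareDual_cohMul (O : CentralOrientation B) (V : VerySpec F)
    (hB : IsBivTheory B) {X : C} (hvs : V.vs (F.tm X)) (α β : B.grp (𝟙 X)) :
    poincareDual O V hvs (cohMul B α β) = cohSmul B α (poincareDual O V hvs β) := by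
  simp only [poincareDual, cohMul, cohSmul, B.mul_tr, B.tr_mul, hB.mul_assoc, B.tr_tr]

theorem cohMul_cohSmul (hB : IsBivTheory B) {X : C} (α β : B.grp (𝟙 X)) (a : B.grp (F.tm X)) :
    cohSmul B (cohMul B α β) a = cohSmul B α (cohSmul B β a) := by
  simp only [cohMul, cohSmul, B.mul_tr, B.tr_mul, hB.mul_assoc, B.tr_tr]

/-- Poincaré duality.  Let `𝔹` be a centrally and stably oriented
bivariant theory such that all absolute product squares are independent and the
independent squares have the cancellation property, let a class of very specialized
morphisms be given, and let `X` be an object whose structure morphism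
`π_X : X ⟶ pt` is very specialized.  Then `− • θ(π_X) : 𝔹^•(X) → 𝔹_•(X)` is an
isomorphism of abelian groups, for all `α, β ∈ 𝔹^•(X)` one has
`(α • β) • θ(π_X) = (α • θ(π_X)) ⌢ (β • θ(π_X))`, and in particular the
intersection product `⌢` on `𝔹_•(X)` is associative. -/
theorem poincare_duality {C : Type u} [Category.{v} C]
    (F : BivFun C) (B : BivData.{w} F) (hB : IsBivTheory B)
    (O : CentralOrientation B) (habs : AbsIndep F)
    (hcv : CancelVert F) (hch : CancelHoriz F) (V : VerySpec F)
    {X P : C} (p1 p2 : P ⟶ X) (hP : IsPullback p1 p2 (F.tm X) (F.tm X))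
    (d : X ⟶ P) (hd1 : d ≫ p1 = 𝟙 X) (hd2 : d ≫ p2 = 𝟙 X)
    (hvs : V.vs (F.tm X)) :
    Function.Bijective (poincareDual O V hvs) ∧
    (∀ α β : B.grp (𝟙 X),
      poincareDual O V hvs (cohMul B α β) =
        interProd habs O V p1 p2 hP d hd1 hvs (poincareDual O V hvs α)
          (poincareDual O V hvs β)) ∧
    (∀ a b c : B.grp (F.tm X),
      interProd habs O V p1 p2 hP d hd1 hvs
          (interProd habs O V p1 p2 hP d hd1 hvs a b) c =
        interProd habs O V p1 p2 hP d hd1 hvs a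
          (interProd habs O V p1 p2 hP d hd1 hvs b c)) := by
  have hinter := interProd_eq_cohSmul habs O V p1 p2 hP d hd1 hd2 hvs hB
  have hright := poincareDual_poincareDualInv habs O V p1 p2 hP d hd1 hd2 hvs hB
  have hleft := poincareDualInv_poincareDual habs O V p1 p2 hP d hd1 hd2 hvs hB
  refine ⟨Function.bijective_iff_has_inverse.mpr ⟨_, hleft, hright⟩, fun α β => ?_,
    fun a b c => ?_⟩
  · rw [hinter, hleft, poincareDual_cohMul O V hB]
  · obtain ⟨α, rfl⟩ : ∃ α, poincareDual O V hvs α = a := ⟨_, hright a⟩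
    obtain ⟨β, rfl⟩ : ∃ β, poincareDual O V hvs β = b := ⟨_, hright b⟩
    simp only [hinter, hleft]
    rw [← poincareDual_cohMul O V hB, hleft, cohMul_cohSmul hB]
end
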